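/- For every positive integer m and every integer x coprime to m, the number of a in (ℤ/m²ℤ)* with C_m(a) ≡ 0 (mod m) equals f(m)·φ(m), where C_m(a) = (a^λ(m) − 1)/m is the Carmichael quotient and f(m) = gcd(m, δ(m)·λ(m)·φ(rad(m))/φ(m)). -/

import Mathlib

/-- The Carmichael function: the exponent of the multiplicative group mod `m`. -/
noncomputable def carmichael (m : ℕ) : ℕ := Monoid.exponent (ZMod m)ˣ

/-- The radical of `m`: the product of the distinct primes dividing `m`. -/
def radN (m : ℕ) : ℕ := ∏ p ∈ m.primeFactors, p

/-- `δ(m) = 2` if `4 ∣ m`, else `1`. -/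
def deltaN (m : ℕ) : ℕ := if 4 ∣ m then 2 else 1

/-- `d(m) = gcd(m, δ(m)·φ(rad m))`. -/
def dFun (m : ℕ) : ℕ := Nat.gcd m (deltaN m * Nat.totient (radN m))

/-- `f(m) = gcd(m, δ(m)·λ(m)·φ(rad m)/φ(m))`. -/
noncomputable def fFun (m : ℕ) : ℕ :=
  Nat.gcd m (deltaN m * carmichael m * Nat.totient (radN m) / Nat.totient m)

theorem radN_dvd (n : ℕ) : radN n ∣ n := Nat.prod_primeFactors_dvd n

theorem radN_prime_pow {p e : ℕ} (hp : p.Prime) (he : 0 < e) : radN (p ^ e) = p := by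
  simp [radN, Nat.primeFactors_prime_pow he.ne' hp]

theorem radN_mul {a b : ℕ} (h : a.Coprime b) : radN (a * b) = radN a * radN b := by
  rw [radN, h.primeFactors_mul, Finset.prod_union h.disjoint_primeFactors, radN, radN]

theorem mul_div_radN_mul {a b : ℕ} (h : a.Coprime b) :
    a * b / radN (a * b) = a / radN a * (b / radN b) := by
  rw [radN_mul h, Nat.div_mul_div_comm (radN_dvd a) (radN_dvd b)]

theorem prime_pow_div_radN {p e : ℕ} (hp : p.Prime) (he : 0 < e) :
    p ^ e / radN (p ^ e) = p ^ (e - 1) := by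
  rw [radN_prime_pow hp he, ← Nat.pow_sub_mul_pow p (show 1 ≤ e from he), pow_one,
    Nat.mul_div_cancel _ hp.pos]

theorem totient_eq_div_radN_mul (n : ℕ) :
    n.totient = n / radN n * (radN n).totient := by
  have hr : (radN n).primeFactors = n.primeFactors :=
    Nat.primeFactors_prod fun p hp => Nat.prime_of_mem_primeFactors hp
  have h0 : 0 < radN n := Finset.prod_pos fun p hp => Nat.pos_of_mem_primeFactors hp
  have hφ : (radN n).totient = ∏ p ∈ n.primeFactors, (p - 1) := by
    rw [Nat.totient_eq_div_primeFactors_mul, hr]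
    change radN n / radN n * _ = _
    rw [Nat.div_self h0, one_mul]
  rw [hφ]
  exact Nat.totient_eq_div_primeFactors_mul n

theorem deltaN_dvd_two (n : ℕ) : deltaN n ∣ 2 := by
  unfold deltaN; split_ifs <;> norm_num

theorem deltaN_of_odd {n : ℕ} (h : Odd n) : deltaN n = 1 := by
  have : ¬ 4 ∣ n := by
    rintro ⟨c, rfl⟩
    exact Nat.not_even_iff_odd.mpr h ⟨2 * c, by ring⟩
  simp [deltaN, this]

theorem deltaN_dvd_deltaN {a b : ℕ} (h : a ∣ b) : deltaN a ∣ deltaN b := by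
  unfold deltaN
  split_ifs with h₁ h₂
  · exact dvd_rfl
  · exact absurd (h₁.trans h) h₂
  · exact one_dvd _
  · exact one_dvd _

theorem deltaN_mul_of_odd {a b : ℕ} (hb : Odd b) : deltaN (a * b) = deltaN a := by
  have hc : Nat.Coprime 4 b := Nat.Coprime.pow_left 2 (Nat.coprime_two_left.mpr hb)
  simp [deltaN, hc.dvd_mul_right]

theorem gcd_deltaN_mul {a b : ℕ} (h : a.Coprime b) {x : ℕ} (hx : x ∣ a ^ 2) (k : ℕ) :
    x.gcd (deltaN (a * b) * k) = x.gcd (deltaN a * k) := by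
  rcases Nat.even_or_odd b with hb | hb
  · have ha : Odd a := by
      rw [← Nat.not_even_iff_odd]
      intro ha
      exact Nat.not_coprime_of_dvd_of_dvd one_lt_two ha.two_dvd hb.two_dvd h
    rw [deltaN_of_odd ha, one_mul]
    refine Nat.Coprime.gcd_mul_left_cancel_right k ?_
    have h2 : Nat.Coprime 2 (a ^ 2) := Nat.coprime_two_left.mpr ha.pow
    exact Nat.Coprime.coprime_dvd_left (deltaN_dvd_two _) (h2.coprime_dvd_right hx)
  · rw [deltaN_mul_of_odd hb]

theorem carmichael_dvd_carmichael {a b : ℕ} (hb : b ≠ 0) (h : a ∣ b) :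
    carmichael a ∣ carmichael b := by
  have : NeZero b := ⟨hb⟩
  have ha : a ≠ 0 := ne_zero_of_dvd_ne_zero hb h
  simpa [carmichael, ArithmeticFunction.carmichael_eq_exponent, ha, hb] using
    ArithmeticFunction.carmichael_dvd h

theorem carmichael_prime {p : ℕ} (hp : p.Prime) : carmichael p = p - 1 := by
  have := Fact.mk hp
  have h := IsCyclic.exponent_eq_card (α := (ZMod p)ˣ)
  rw [carmichael, h, Nat.card_eq_fintype_card, ZMod.card_units_eq_totient, Nat.totient_prime hp]

theorem carmichael_four : carmichael 4 = 2 := by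
  have h := ArithmeticFunction.carmichael_two_pow_of_le_two (n := 2) le_rfl
  rw [ArithmeticFunction.carmichael_eq_exponent (by norm_num)] at h
  exact h

theorem div_radN_dvd_deltaN_mul_carmichael {n : ℕ} (hn : n ≠ 0) :
    n / radN n ∣ deltaN n * carmichael n := by
  induction n using Nat.recOnPosPrimePosCoprime with
  | zero => exact absurd rfl hn
  | one => simp [radN]
  | prime_pow p e hp he =>
    rw [prime_pow_div_radN hp he]
    have hc := ArithmeticFunction.carmichael_eq_exponent hn
    rw [carmichael, ← hc]
    by_cases h2 : p = 2
    · subst h2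
      rcases Nat.lt_or_ge 2 e with h | h
      · have h4 : 4 ∣ 2 ^ e := pow_dvd_pow 2 h.le
        rw [ArithmeticFunction.carmichael_two_pow_of_ne_two (by omega), deltaN, if_pos h4,
          ← pow_succ']
        exact pow_dvd_pow 2 (by omega)
      · rw [ArithmeticFunction.carmichael_two_pow_of_le_two h]
        exact dvd_mul_left _ _
    · rw [ArithmeticFunction.carmichael_pow_of_prime_ne_two e hp h2, Nat.totient_prime_pow hp he]
      exact (dvd_mul_right _ _).mul_left _
  | coprime a b ha hb hab iha ihb =>
    rw [mul_div_radN_mul hab]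
    refine Nat.Coprime.mul_dvd_of_dvd_of_dvd ?_ ?_ ?_
    · exact (hab.coprime_dvd_left (Nat.div_dvd_of_dvd (radN_dvd a))).coprime_dvd_right
        (Nat.div_dvd_of_dvd (radN_dvd b))
    · exact (iha (by omega)).trans (mul_dvd_mul (deltaN_dvd_deltaN (dvd_mul_right a b))
        (carmichael_dvd_carmichael hn (dvd_mul_right a b)))
    · exact (ihb (by omega)).trans (mul_dvd_mul (deltaN_dvd_deltaN (dvd_mul_left b a))
        (carmichael_dvd_carmichael hn (dvd_mul_left b a)))

theorem fFun_mul_totient {m : ℕ} (hm : 0 < m) :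
    fFun m * m.totient =
      (radN m).totient * (m * (m / radN m)).gcd (deltaN m * carmichael m) := by
  obtain ⟨c, hc⟩ := div_radN_dvd_deltaN_mul_carmichael hm.ne'
  have ht : 0 < m.totient := Nat.totient_pos.mpr hm
  rw [fFun, totient_eq_div_radN_mul m, hc]
  rw [totient_eq_div_radN_mul m] at ht
  rw [show m / radN m * c * (radN m).totient = c * (m / radN m * (radN m).totient) by ring,
    Nat.mul_div_cancel _ ht, mul_comm m, Nat.gcd_mul_left]
  ring

/-- The number of units of `ZMod n` whose `k`-th power is `1`. -/
noncomputable def cardPowEqOne (n k : ℕ) : ℕ :=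
  Nat.card (powMonoidHom k : (ZMod n)ˣ →* (ZMod n)ˣ).ker

theorem cardPowEqOne_mul {a b : ℕ} (h : a.Coprime b) (k : ℕ) :
    cardPowEqOne (a * b) k = cardPowEqOne a k * cardPowEqOne b k := by
  let e : (ZMod (a * b))ˣ ≃* (ZMod a)ˣ × (ZMod b)ˣ :=
    (Units.mapEquiv (ZMod.chineseRemainder h).toMulEquiv).trans MulEquiv.prodUnits
  rw [cardPowEqOne, cardPowEqOne, cardPowEqOne, ← Nat.card_prod]
  refine Nat.card_congr ((e.toEquiv.subtypeEquiv (q := fun x => x.1 ∈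
    (powMonoidHom k : (ZMod a)ˣ →* (ZMod a)ˣ).ker ∧ x.2 ∈
    (powMonoidHom k : (ZMod b)ˣ →* (ZMod b)ˣ).ker) fun x => ?_).trans
    Equiv.subtypeProdEquivProd)
  simp only [MonoidHom.mem_ker, powMonoidHom_apply]
  rw [← map_eq_one_iff e e.injective, map_pow, Prod.ext_iff]
  rfl

theorem cardPowEqOne_odd_prime_pow {p e k : ℕ} (hp : p.Prime) (hp2 : p ≠ 2) (he : 0 < e)
    (hk : p - 1 ∣ k) : cardPowEqOne (p ^ e) k = (p - 1) * (p ^ (e - 1)).gcd k := by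
  have : NeZero p := ⟨hp.ne_zero⟩
  have := ZMod.isCyclic_units_of_prime_pow p hp hp2 e
  rw [cardPowEqOne, IsCyclic.card_powMonoidHom_ker, Nat.card_eq_fintype_card,
    ZMod.card_units_eq_totient, Nat.totient_prime_pow hp he]
  have hc : (p ^ (e - 1)).Coprime (p - 1) := by
    refine Nat.Coprime.pow_left _ ?_
    rw [Nat.coprime_self_sub_right hp.one_le]
    exact Nat.coprime_one_right p
  rw [Nat.gcd_comm, hc.gcd_mul, Nat.gcd_eq_right hk, Nat.gcd_comm, mul_comm]

theorem cardPowEqOne_two_pow {n k : ℕ} (hk : 2 ∣ k) :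
    cardPowEqOne (2 ^ (n + 2)) k = 2 * (2 ^ n).gcd k := by
  let u : (ZMod (2 ^ (n + 2)))ˣ := ZMod.unitOfCoprime 5 (Nat.Coprime.pow_right _ (by norm_num))
  have hu : orderOf u = 2 ^ n := by
    rw [← ZMod.orderOf_five n, ← orderOf_units]
    simp [u]
  have hcard : Nat.card (ZMod (2 ^ (n + 2)))ˣ = 2 * 2 ^ n := by
    rw [Nat.card_eq_fintype_card, ZMod.card_units_eq_totient,
      Nat.totient_prime_pow Nat.prime_two (by omega)]
    simp [pow_succ']
  have hindex : (Subgroup.zpowers u).index = 2 := by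
    have h := (Subgroup.zpowers u).card_mul_index
    rw [Nat.card_zpowers, hu, hcard, mul_comm] at h
    exact Nat.eq_of_mul_eq_mul_right (by positivity) h
  have hneg : (-1 : (ZMod (2 ^ (n + 2)))ˣ) ∉ Subgroup.zpowers u := by
    have h4 : (4 : ℕ) ∣ 2 ^ (n + 2) := ⟨2 ^ n, by ring⟩
    intro hmem
    have hle : Subgroup.zpowers u ≤ (ZMod.unitsMap h4).ker := by
      rw [Subgroup.zpowers_le, MonoidHom.mem_ker]
      ext
      simp only [u, ZMod.unitsMap_def, Units.coe_map, ZMod.coe_unitOfCoprime, MonoidHom.coe_coe,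
        map_natCast]
      rfl
    have h1 := congrArg Units.val (MonoidHom.mem_ker.mp (hle hmem))
    simp only [ZMod.unitsMap_def, Units.coe_map, MonoidHom.coe_coe, Units.val_neg, Units.val_one,
      map_neg, map_one] at h1
    exact absurd h1 (by decide)
  have hrange : (powMonoidHom k : (ZMod (2 ^ (n + 2)))ˣ →* _).range = Subgroup.zpowers (u ^ k) := by
    apply le_antisymm
    · rintro _ ⟨a, rfl⟩
      have hmem : ∀ b ∈ Subgroup.zpowers u, b ^ k ∈ Subgroup.zpowers (u ^ k) := by
        rintro _ ⟨i, rfl⟩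
        exact ⟨i, by simp only [← zpow_natCast, ← zpow_mul, mul_comm]⟩
      by_cases ha : a ∈ Subgroup.zpowers u
      · exact hmem a ha
      · have h := hmem (-1 * a) (by
          rw [Subgroup.mul_mem_iff_of_index_two hindex]
          simp [ha, hneg])
        rwa [neg_one_mul, (even_iff_two_dvd.mpr hk).neg_pow] at h
    · rw [Subgroup.zpowers_le]
      exact ⟨u, rfl⟩
  have h := (powMonoidHom k : (ZMod (2 ^ (n + 2)))ˣ →* _).ker.card_mul_index
  rw [Subgroup.index_ker, hrange, Nat.card_zpowers, orderOf_pow, hu, hcard] at h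
  have hg := Nat.gcd_dvd_left (2 ^ n) k
  have hpos : 0 < 2 ^ n / (2 ^ n).gcd k :=
    Nat.div_pos (Nat.le_of_dvd (by positivity) hg) (Nat.gcd_pos_of_pos_left _ (by positivity))
  refine Nat.eq_of_mul_eq_mul_right hpos (h.trans ?_)
  rw [mul_assoc, Nat.mul_div_cancel' hg]

theorem cardPowEqOne_sq {n : ℕ} (hn : n ≠ 0) {k : ℕ} (hk : ∀ p, p.Prime → p ∣ n → p - 1 ∣ k)
    (hk4 : 4 ∣ n → 2 ∣ k) :
    cardPowEqOne (n ^ 2) k = (radN n).totient * (n * (n / radN n)).gcd (deltaN n * k) := by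
  induction n using Nat.recOnPosPrimePosCoprime with
  | zero => exact absurd rfl hn
  | one =>
    rw [one_pow, cardPowEqOne, Nat.card_unique]
    simp [radN]
  | prime_pow p e hp he =>
    rw [prime_pow_div_radN hp he, radN_prime_pow hp he, Nat.totient_prime hp, ← pow_mul, ← pow_add]
    by_cases h2 : p = 2
    · subst h2
      rcases Nat.eq_or_lt_of_le (Nat.one_le_iff_ne_zero.mpr he.ne') with rfl | h
      · have : IsCyclic (ZMod (2 ^ (1 * 2)))ˣ := ZMod.isCyclic_units_four
        rw [cardPowEqOne, IsCyclic.card_powMonoidHom_ker, Nat.card_eq_fintype_card,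
          ZMod.card_units_eq_totient, Nat.totient_prime_pow Nat.prime_two (by norm_num)]
        norm_num [deltaN]
      · have h4 : 4 ∣ 2 ^ e := pow_dvd_pow 2 h
        obtain ⟨d, rfl⟩ := Nat.exists_eq_add_of_le' h
        rw [deltaN, if_pos h4, show (d + Nat.succ 1) * 2 = 2 * d + 2 + 2 by omega,
          cardPowEqOne_two_pow (hk4 h4), ← Nat.gcd_mul_left, ← pow_succ', Nat.add_one_sub_one,
          one_mul]
        congr 2
        omega
    · have ho : Odd (p ^ e) := (hp.odd_of_ne_two h2).pow
      rw [deltaN_of_odd ho, one_mul, cardPowEqOne_odd_prime_pow hp h2 (by omega)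
        (hk p hp (dvd_pow_self p he.ne'))]
      congr 3
      omega
  | coprime a b ha hb hab iha ihb =>
    have hsq : ∀ c : ℕ, c * (c / radN c) ∣ c ^ 2 := fun c => by
      rw [sq]
      exact mul_dvd_mul_left c (Nat.div_dvd_of_dvd (radN_dvd c))
    have hrad : (radN a).Coprime (radN b) :=
      (hab.coprime_dvd_left (radN_dvd a)).coprime_dvd_right (radN_dvd b)
    have hq : (a * (a / radN a)).Coprime (b * (b / radN b)) :=
      ((hab.pow 2 2).coprime_dvd_left (hsq a)).coprime_dvd_right (hsq b)
    rw [mul_pow, cardPowEqOne_mul (hab.pow 2 2),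
      iha (by omega) (fun p hp h => hk p hp (h.mul_right b)) (fun h => hk4 (h.mul_right b)),
      ihb (by omega) (fun p hp h => hk p hp (h.mul_left a)) (fun h => hk4 (h.mul_left a)),
      mul_div_radN_mul hab, radN_mul hab, Nat.totient_mul hrad, mul_mul_mul_comm a b,
      Nat.gcd_comm (_ * _ * (_ * _)), hq.gcd_mul, Nat.gcd_comm _ (a * _), Nat.gcd_comm _ (b * _),
      gcd_deltaN_mul hab (hsq a), mul_comm a b, gcd_deltaN_mul hab.symm (hsq b)]
    ring

theorem dvd_carmichael_quotient_iff {m : ℕ} (hm : 0 < m) (a : (ZMod (m ^ 2))ˣ) :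
    (m : ℤ) ∣ (((a : ZMod (m ^ 2)).val : ℤ) ^ carmichael m - 1) / (m : ℤ) ↔
      a ^ carmichael m = 1 := by
  have : NeZero m := ⟨hm.ne'⟩
  have hdvd : m ∣ m ^ 2 := dvd_pow_self m two_ne_zero
  have h : (m : ℤ) ∣ ((a : ZMod (m ^ 2)).val : ℤ) ^ carmichael m - 1 := by
    have h1 := congrArg Units.val (Monoid.pow_exponent_eq_one (ZMod.unitsMap hdvd a))
    rw [Units.val_pow_eq_pow_val, ZMod.unitsMap_val, Units.val_one] at h1
    rw [← ZMod.intCast_zmod_eq_zero_iff_dvd]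
    push_cast
    rw [ZMod.natCast_val, carmichael, h1, sub_self]
  rw [Int.dvd_div_iff_mul_dvd h, ← sq, ← Nat.cast_pow, ← ZMod.intCast_zmod_eq_zero_iff_dvd]
  push_cast
  rw [ZMod.natCast_zmod_val, sub_eq_zero, Units.ext_iff, Units.val_pow_eq_pow_val, Units.val_one]

theorem card_carmichael_quotient_zero (m : ℕ) (hm : 0 < m) :
    Nat.card {a : (ZMod (m ^ 2))ˣ //
        (m : ℤ) ∣ (((a : ZMod (m ^ 2)).val : ℤ) ^ carmichael m - 1) / (m : ℤ)} =
      fFun m * Nat.totient m := by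
  rw [fFun_mul_totient hm, ← cardPowEqOne_sq hm.ne'
    (fun p hp h => carmichael_prime hp ▸ carmichael_dvd_carmichael hm.ne' h)
    (fun h => carmichael_four ▸ carmichael_dvd_carmichael hm.ne' h)]
  exact Nat.card_congr (Equiv.subtypeEquivRight (dvd_carmichael_quotient_iff hm))
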